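/- For all integers k ≥ 2 and b with 1 ≤ b ≤ k/2, the function g has exactly one zero on (0, ∞), and this zero is strictly less than z* = 5·2^b. -/

import Mathlib

/-- A nonnegative multiple of a power of `1 + 1 / (M z + M - 1)`, minus `z`, is strictly
decreasing on `(0, ∞)`. -/
theorem strictAntiOn_mul_one_add_div_pow_sub {A M : ℝ} (hA : 0 ≤ A) (hM : 1 ≤ M) (d : ℕ) :
    StrictAntiOn (fun z : ℝ => A * (1 + 1 / (M * z + M - 1)) ^ d - z) (Set.Ioi 0) := by
  intro x hx y _ hxy
  have hx : 0 < x := hx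
  have hDx : 0 < M * x + M - 1 := by nlinarith
  have hle : M * x + M - 1 ≤ M * y + M - 1 := by nlinarith
  have hDy : 0 < M * y + M - 1 := hDx.trans_le hle
  have : A * (1 + 1 / (M * y + M - 1)) ^ d ≤ A * (1 + 1 / (M * x + M - 1)) ^ d := by
    gcongr
  simp only
  linarith

theorem continuousOn_mul_one_add_div_pow_sub {M : ℝ} (A : ℝ) (hM : 1 ≤ M) (d : ℕ) :
    ContinuousOn (fun z : ℝ => A * (1 + 1 / (M * z + M - 1)) ^ d - z) (Set.Ioi 0) := by
  have hne : ∀ x ∈ Set.Ioi (0 : ℝ), M * x + M - 1 ≠ 0 := by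
    intro x hx
    have hx : 0 < x := hx
    have : 0 < M * x + M - 1 := by nlinarith
    exact this.ne'
  fun_prop (disch := assumption)

theorem one_add_one_div_pow_le_exp_one {D : ℝ} (hD : 0 < D) {d : ℕ} (hd : (d : ℝ) ≤ D) :
    (1 + 1 / D) ^ d ≤ Real.exp 1 := by
  calc (1 + 1 / D) ^ d ≤ Real.exp (1 / D) ^ d := by
        gcongr
        linarith [Real.add_one_le_exp (1 / D)]
    _ = Real.exp (d * (1 / D)) := (Real.exp_nat_mul _ _).symm
    _ ≤ Real.exp 1 := by
        gcongr
        rw [mul_one_div]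
        exact (div_le_one hD).2 hd

/-- For integers `k ≥ 2`, `1 ≤ b ≤ k/2`, with `d = 5·2^(k-b)` and `z* = 5·2^b`,
the function `g` has exactly one zero on `(0, ∞)`, and this zero is strictly
smaller than `z*`. -/
theorem g_unique_zero (k b : ℕ) (hk : 2 ≤ k) (hb : 1 ≤ b) (hbk : 2 * b ≤ k) :
    ∃ z : ℝ, 0 < z ∧ z < 5 * 2 ^ b ∧
      ((2 : ℝ) ^ b - 1) *
          (1 + 1 / ((2 : ℝ) ^ (k - 2 * b) * z + (2 : ℝ) ^ (k - 2 * b) - 1))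
            ^ (5 * 2 ^ (k - b)) - z = 0 ∧
      ∀ w : ℝ, 0 < w →
        ((2 : ℝ) ^ b - 1) *
            (1 + 1 / ((2 : ℝ) ^ (k - 2 * b) * w + (2 : ℝ) ^ (k - 2 * b) - 1))
              ^ (5 * 2 ^ (k - b)) - w = 0 → w = z := by
  have hB : (2 : ℝ) ≤ 2 ^ b := le_self_pow₀ one_le_two (by omega)
  have hM : (1 : ℝ) ≤ 2 ^ (k - 2 * b) := one_le_pow₀ one_le_two
  have hd : ((5 * 2 ^ (k - b) : ℕ) : ℝ) = 2 ^ (k - 2 * b) * (5 * 2 ^ b) := by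
    have : k - b = (k - 2 * b) + b := by omega
    rw [this]
    push_cast
    ring
  generalize 5 * 2 ^ (k - b) = d at *
  generalize (2 : ℝ) ^ b = B at *
  generalize (2 : ℝ) ^ (k - 2 * b) = M at *
  have hanti := strictAntiOn_mul_one_add_div_pow_sub (A := B - 1) (by linarith) hM d
  have hcont := continuousOn_mul_one_add_div_pow_sub (B - 1) hM d
  set g : ℝ → ℝ := fun z => (B - 1) * (1 + 1 / (M * z + M - 1)) ^ d - z with hg
  have hleft : 0 ≤ g (B - 1) := by
    have hD : 0 < M * (B - 1) + M - 1 := by nlinarith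
    have hpow : 1 ≤ (1 + 1 / (M * (B - 1) + M - 1)) ^ d :=
      one_le_pow₀ (le_add_of_nonneg_right (one_div_pos.2 hD).le)
    simp only [hg]
    nlinarith
  have hright : g (5 * B) < 0 := by
    have hD : 0 < M * (5 * B) + M - 1 := by nlinarith
    have hpow := one_add_one_div_pow_le_exp_one hD (d := d) (by linarith)
    have he := Real.exp_one_lt_d9
    simp only [hg]
    nlinarith
  obtain ⟨z, ⟨hz₁, hz₂⟩, hz⟩ := intermediate_value_Icc' (by linarith : B - 1 ≤ 5 * B)
    (hcont.mono fun x hx => Set.mem_Ioi.2 (by linarith [hx.1])) ⟨hright.le, hleft⟩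
  have hz0 : 0 < z := by linarith
  refine ⟨z, hz0, lt_of_le_of_ne hz₂ ?_, hz, fun w hw hgw => ?_⟩
  · rintro rfl
    exact hright.ne hz
  · exact hanti.injOn hw hz0 (hgw.trans hz.symm)
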